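/- arXiv:2303.18065 — 2 statements merged into one kernel-verified Lean document; each statement's English description precedes it below -/
import Mathlib

section
/- For every α ∈ Φ and every θ ∈ R, the scalar ⟨θ,α^∨⟩ := 2(α,α)⁻¹(θ,α) is an integer and θ − ⟨θ,α^∨⟩α ∈ R; moreover the reflection preserves root-space dimensions: dim_k (g₀)_θ = dim_k (g₀)_{θ−⟨θ,α^∨⟩α} when θ ∈ Φ, and dim_k (g₁)_θ = dim_k (g₁)_{θ−⟨θ,α^∨⟩α} when θ ∈ Γ. -/
/-- A finite-dimensional Lie superalgebra `g = g₀ ⊕ g₁`: a Lie algebra `g₀`,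
a `g₀`-module `g₁` (action `act`), and a symmetric bracket `br : g₁ × g₁ → g₀`
satisfying invariance and the super Jacobi identity. -/
structure LieSuperData (k g0 g1 : Type*) [Field k] [LieRing g0] [LieAlgebra k g0]
    [AddCommGroup g1] [Module k g1] where
  act : g0 →ₗ[k] g1 →ₗ[k] g1
  act_lie : ∀ (x y : g0) (u : g1), act ⁅x, y⁆ u = act x (act y u) - act y (act x u)
  br : g1 →ₗ[k] g1 →ₗ[k] g0
  br_symm : ∀ u v : g1, br u v = br v u
  br_invariance : ∀ (x : g0) (u v : g1), ⁅x, br u v⁆ = br (act x u) v + br u (act x v)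
  super_jacobi : ∀ u v w : g1, act (br u v) w + act (br v w) u + act (br w u) v = 0

/-- A nondegenerate even supersymmetric invariant bilinear form `B = (B₀, B₁)` on a
Lie superalgebra. -/
structure InvForm {k g0 g1 : Type*} [Field k] [LieRing g0] [LieAlgebra k g0]
    [AddCommGroup g1] [Module k g1] (D : LieSuperData k g0 g1) where
  B0 : g0 →ₗ[k] g0 →ₗ[k] k
  B1 : g1 →ₗ[k] g1 →ₗ[k] k
  B0_symm : ∀ x y : g0, B0 x y = B0 y x
  B0_invariant : ∀ x y z : g0, B0 ⁅x, y⁆ z = B0 x ⁅y, z⁆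
  B1_alt : ∀ u v : g1, B1 u v = - B1 v u
  compat : ∀ (x : g0) (u v : g1), B0 x (D.br u v) = B1 (D.act x u) v
  B0_nondeg : ∀ x : g0, (∀ y : g0, B0 x y = 0) → x = 0
  B1_nondeg : ∀ u : g1, (∀ v : g1, B1 u v = 0) → u = 0

/-- The weight space `(g₀)_α = {x ∈ g₀ : ⁅H, x⁆ = α(H) x for all H ∈ t}`. -/
def evenSpace {k g0 : Type*} [Field k] [LieRing g0] [LieAlgebra k g0]
    (t : LieSubalgebra k g0) (α : Module.Dual k t) : Submodule k g0 where
  carrier := {x | ∀ H : t, ⁅(H : g0), x⁆ = α H • x}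
  add_mem' := by
    intro a b ha hb H
    rw [lie_add, ha H, hb H, smul_add]
  zero_mem' := by
    intro H
    rw [lie_zero, smul_zero]
  smul_mem' := by
    intro c x hx H
    rw [lie_smul, hx H, smul_comm]

/-- The weight space `(g₁)_γ = {u ∈ g₁ : H · u = γ(H) u for all H ∈ t}`. -/
def oddSpace {k g0 g1 : Type*} [Field k] [LieRing g0] [LieAlgebra k g0]
    [AddCommGroup g1] [Module k g1] (D : LieSuperData k g0 g1)
    (t : LieSubalgebra k g0) (γ : Module.Dual k t) : Submodule k g1 where
  carrier := {u | ∀ H : t, D.act (H : g0) u = γ H • u}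
  add_mem' := by
    intro a b ha hb H
    rw [map_add, ha H, hb H, smul_add]
  zero_mem' := by
    intro H
    rw [map_zero, smul_zero]
  smul_mem' := by
    intro c u hu H
    rw [map_smul, hu H, smul_comm]

/-- The induced form on weights: `(θ, η) := B₀(H_θ, H_η)`. -/
def pairing {k g0 : Type*} [Field k] [LieRing g0] [LieAlgebra k g0]
    {t : LieSubalgebra k g0} (B0 : g0 →ₗ[k] g0 →ₗ[k] k)
    (Hd : Module.Dual k t → t) (θ η : Module.Dual k t) : k :=
  B0 (Hd θ : g0) (Hd η : g0)


theorem exp_mul_eq_of_lie_lie_lie_eq_zero {A : Type*} [Ring A] [Algebra ℚ A] {e y z w : A}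
    (he : IsNilpotent e) (hy : e * y - y * e = z) (hz : e * z - z * e = w)
    (hw : e * w - w * e = 0) :
    IsNilpotent.exp e * y = (y + z + (2 : ℚ)⁻¹ • w) * IsNilpotent.exp e := by
  set l : Module.End ℚ A := LinearMap.mulLeft ℚ e with hl
  set r : Module.End ℚ A := LinearMap.mulRight ℚ e with hr
  have hlr : Commute l r := LinearMap.commute_mulLeft_right e e
  have hln : IsNilpotent l := (LinearMap.isNilpotent_mulLeft_iff ℚ e).mpr he
  have hrn : IsNilpotent r := (LinearMap.isNilpotent_mulRight_iff ℚ e).mpr he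
  have hdr : Commute r (l - r) := hlr.symm.sub_right (Commute.refl r)
  have hdn : IsNilpotent (l - r) := hlr.isNilpotent_sub hln hrn
  have hd (x : A) : (l - r) x = e * x - x * e := by simp [hl, hr]
  have h_exp : IsNilpotent.exp l = IsNilpotent.exp r * IsNilpotent.exp (l - r) := by
    rw [← IsNilpotent.exp_add_of_commute hdr hrn hdn, add_sub_cancel]
  obtain ⟨n, hn⟩ := id he
  have hl_exp (x : A) : IsNilpotent.exp l x = IsNilpotent.exp e * x := by
    have hln' : l ^ n = 0 := by rw [hl, LinearMap.pow_mulLeft, hn, LinearMap.mulLeft_zero_eq_zero]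
    rw [IsNilpotent.exp_eq_sum hln', IsNilpotent.exp_eq_sum hn]
    simp [Finset.sum_mul, hl, LinearMap.pow_mulLeft]
  have hr_exp (x : A) : IsNilpotent.exp r x = x * IsNilpotent.exp e := by
    have hrn' : r ^ n = 0 := by
      rw [hr, LinearMap.pow_mulRight, hn, LinearMap.mulRight_zero_eq_zero]
    rw [IsNilpotent.exp_eq_sum hrn', IsNilpotent.exp_eq_sum hn]
    simp [Finset.mul_sum, hr, LinearMap.pow_mulRight]
  have hd_exp : IsNilpotent.exp (l - r) y = y + z + (2 : ℚ)⁻¹ • w := by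
    have h3 : ((l - r) ^ 3) • y = 0 := by
      simp only [pow_succ', pow_zero, mul_one, Module.End.smul_def, Module.End.mul_apply, hd y, hy,
        hd z, hz, hd w, hw]
    have := IsNilpotent.exp_smul_eq_sum h3 hdn
    simp only [Module.End.smul_def] at this
    rw [this]
    simp [Finset.sum_range_succ, pow_succ', hd y, hy, hd z, hz]
  rw [← hl_exp, h_exp, Module.End.mul_apply, hr_exp, hd_exp]

theorem exists_isUnit_mul_eq_sub_smul_mul {k A : Type*} [Field k] [CharZero k] [Ring A]
    [Algebra k A] {h e f : A} (he : IsNilpotent e) (hf : IsNilpotent f) (hef : e * f - f * e = h)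
    (hhe : h * e - e * h = (2 : k) • e) (hhf : h * f - f * h = -((2 : k) • f)) :
    ∃ s : A, IsUnit s ∧ ∀ (x : A) (c : k), x * e - e * x = c • e → x * f - f * x = -(c • f) →
      s * x = (x - c • h) * s := by
  let _ : Algebra ℚ A := Algebra.compHom A (algebraMap ℚ k)
  have hsmul (q : ℚ) (a : A) : q • a = (q : k) • a := rfl
  refine ⟨IsNilpotent.exp e * IsNilpotent.exp (-f) * IsNilpotent.exp e,
    ((IsNilpotent.isUnit_exp he).mul (IsNilpotent.isUnit_exp hf.neg)).mul
      (IsNilpotent.isUnit_exp he), fun x c hxe hxf ↦ ?_⟩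
  have hex : e * x = x * e - c • e := by rw [← hxe]; abel
  have hfx : f * x = x * f + c • f := by rw [← sub_neg_eq_add, ← hxf]; abel
  have heh : e * h = h * e - (2 : k) • e := by rw [← hhe]; abel
  have hfh : f * h = h * f + (2 : k) • f := by rw [← sub_neg_eq_add, ← hhf]; abel
  have hef' : e * f = f * e + h := by rw [← hef]; abel
  have h₁ : IsNilpotent.exp e * x = (x - c • e) * IsNilpotent.exp e := by
    rw [exp_mul_eq_of_lie_lie_lie_eq_zero he (z := -(c • e)) (w := 0)
      (by rw [hex]; abel) (by simp) (by simp)]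
    simp [sub_eq_add_neg]
  have h₂ : IsNilpotent.exp (-f) * (x - c • e) =
      (x - c • e - c • h) * IsNilpotent.exp (-f) := by
    rw [exp_mul_eq_of_lie_lie_lie_eq_zero hf.neg (z := -(c • f) - c • h) (w := (2 * c) • f)
      (by simp only [mul_sub, sub_mul, neg_mul, mul_neg, mul_smul_comm, smul_mul_assoc, hfx, hef']
          module)
      (by simp only [mul_sub, sub_mul, neg_mul, mul_neg, mul_smul_comm, smul_mul_assoc, hfh]
          module)
      (by simp)]
    congr 1
    rw [hsmul]
    push_cast
    module
  have h₃ : IsNilpotent.exp e * (x - c • e - c • h) = (x - c • h) * IsNilpotent.exp e := by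
    rw [exp_mul_eq_of_lie_lie_lie_eq_zero he (z := c • e) (w := 0)
      (by simp only [mul_sub, sub_mul, mul_smul_comm, smul_mul_assoc, hex, heh]
          module)
      (by simp) (by simp)]
    congr 1
    rw [smul_zero]
    abel
  rw [mul_assoc, h₁, ← mul_assoc, mul_assoc _ _ (x - c • e), h₂, ← mul_assoc, h₃, mul_assoc,
    mul_assoc, mul_assoc]

theorem isNilpotent_of_mul_sub_mul_eq_smul {k V : Type*} [Field k] [CharZero k]
    [AddCommGroup V] [Module k V] [FiniteDimensional k V] {x e : Module.End k V} {c : k}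
    (hc : c ≠ 0) (h : x * e - e * x = c • e) : IsNilpotent e := by
  by_contra he
  have hpow (n : ℕ) : (LinearMap.mulLeft k x - LinearMap.mulRight k x) (e ^ n) = (n * c) • e ^ n := by
    rw [LinearMap.sub_apply, LinearMap.mulLeft_apply, LinearMap.mulRight_apply]
    induction n with
    | zero => simp
    | succ n ih =>
      have : x * e ^ (n + 1) - e ^ (n + 1) * x =
          (x * e ^ n - e ^ n * x) * e + e ^ n * (x * e - e * x) := by
        rw [pow_succ]; noncomm_ring
      rw [this, ih, h, smul_mul_assoc, mul_smul_comm, ← pow_succ, ← add_smul]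
      push_cast
      ring_nf
  have hinj : Function.Injective fun n : ℕ ↦ (n * c : k) := fun m n hmn ↦ by
    simpa [hc] using hmn
  refine Set.infinite_of_injective_forall_mem hinj (fun n ↦ ?_)
    (Module.End.finite_hasEigenvalue ((LinearMap.mulLeft k x - LinearMap.mulRight k x)))
  exact Module.End.hasEigenvalue_of_hasEigenvector
    (Module.End.hasEigenvector_iff.mpr
      ⟨Module.End.mem_eigenspace_iff.mpr (hpow n), fun h0 ↦ he ⟨n, h0⟩⟩)

theorem eq_zero_of_hasEigenvalue_commutator {k V : Type*} [Field k] [CharZero k]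
    [AddCommGroup V] [Module k V] [FiniteDimensional k V] {x y z : Module.End k V}
    (hz : x * y - y * x = z) (hzx : Commute z x) (hzy : Commute z y) {c : k}
    (hc : z.HasEigenvalue c) : c = 0 := by
  have hx := Module.End.mapsTo_genEigenspace_of_comm hzx c 1
  have hy := Module.End.mapsTo_genEigenspace_of_comm hzy c 1
  set x' := x.restrict hx
  set y' := y.restrict hy
  have hlie : ⁅x', y'⁆ = c • (1 : Module.End k (z.eigenspace c)) := by
    ext ⟨v, hv⟩
    have : z v = c • v := Module.End.mem_eigenspace_iff.mp hv
    rw [← hz] at this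
    exact this
  have htr := LinearMap.trace_lie x' y'
  rw [hlie, map_smul, LinearMap.trace_one, smul_eq_mul, mul_eq_zero, Nat.cast_eq_zero,
    Submodule.finrank_eq_zero] at htr
  exact htr.resolve_right hc

theorem exists_intCast_eq_of_apply_eq_smul {k V : Type*} [Field k] [CharZero k]
    [AddCommGroup V] [Module k V] [FiniteDimensional k V] {h e f : Module.End k V}
    (hef : e * f - f * e = h) (hhe : h * e - e * h = (2 : k) • e)
    (hhf : h * f - f * h = -((2 : k) • f)) {v : V} (hv : v ≠ 0) {c : k} (hc : h v = c • v) :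
    ∃ n : ℤ, (n : k) = c := by
  let _ : LieRing (Module.End k V) := LieRing.ofAssociativeRing
  have he : IsNilpotent e := isNilpotent_of_mul_sub_mul_eq_smul two_ne_zero hhe
  rcases eq_or_ne h 0 with rfl | h0
  · refine ⟨0, ?_⟩
    rw [LinearMap.zero_apply, eq_comm, smul_eq_zero_iff_left hv] at hc
    simp [hc]
  have ht : IsSl2Triple h e f :=
    { h_ne_zero := h0
      lie_e_f := hef
      lie_h_e_nsmul := by rw [Ring.lie_def, hhe, two_smul, two_nsmul]
      lie_h_f_nsmul := by rw [Ring.lie_def, hhf, two_smul, two_nsmul] }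
  have hpow (n : ℕ) : h ((e ^ n) v) = (c + 2 * n) • (e ^ n) v :=
    ht.lie_h_pow_toEnd_e (M := V) hc n
  have hex : ∃ n, (e ^ n) v = 0 := he.imp fun n hn ↦ by rw [hn, LinearMap.zero_apply]
  obtain ⟨n, hn, hn'⟩ := Nat.exists_not_and_succ_of_not_zero_of_exists
    (p := fun n ↦ (e ^ n) v = 0) hv hex
  have hprim : ht.HasPrimitiveVectorWith ((e ^ n) v) (c + 2 * n : k) :=
    { ne_zero := hn
      lie_h := hpow n
      lie_e := by rw [Module.End.lie_apply, ← hn', pow_succ', Module.End.mul_apply] }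
  obtain ⟨m, hm⟩ := hprim.exists_nat
  exact ⟨m - 2 * n, by push_cast; rw [← hm]; ring⟩

theorem exists_intCast_eq_and_finrank_eq_of_representation {k L V : Type*} [Field k] [CharZero k]
    [LieRing L] [LieAlgebra k L] [AddCommGroup V] [Module k V] [FiniteDimensional k V]
    (ρ : L →ₗ[k] Module.End k V) (hρ : ∀ x y, ρ ⁅x, y⁆ = ρ x * ρ y - ρ y * ρ x)
    (t : LieSubalgebra k L) (W : Module.Dual k t → Submodule k V)
    (hW : ∀ θ v, v ∈ W θ ↔ ∀ H : t, ρ H v = θ H • v)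
    {α : Module.Dual k t} {h : t} {e f : L} (hαh : α h = 2) (he : e ∈ evenSpace t α)
    (hf : f ∈ evenSpace t (-α)) (hef : ⁅e, f⁆ = h) (θ : Module.Dual k t) :
    (W θ ≠ ⊥ → ∃ n : ℤ, (n : k) = θ h) ∧
      Module.finrank k (W θ) = Module.finrank k (W (θ - θ h • α)) := by
  have hHe (H : t) : ρ H * ρ e - ρ e * ρ H = α H • ρ e := by rw [← hρ, he H, map_smul]
  have hHf (H : t) : ρ H * ρ f - ρ f * ρ H = -(α H • ρ f) := by
    rw [← hρ, hf H, map_smul, LinearMap.neg_apply, neg_smul]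
  have hhe := hHe h
  have hhf := hHf h
  have hef' : ρ e * ρ f - ρ f * ρ e = ρ h := by rw [← hρ, hef]
  rw [hαh] at hhe hhf
  constructor
  · intro hbot
    obtain ⟨v, hv, hv0⟩ := Submodule.exists_mem_ne_zero_of_ne_bot hbot
    exact exists_intCast_eq_of_apply_eq_smul hef' hhe hhf hv0 ((hW θ v).mp hv h)
  obtain ⟨s, hs, hsx⟩ := exists_isUnit_mul_eq_sub_smul_mul
    (isNilpotent_of_mul_sub_mul_eq_smul two_ne_zero hhe)
    (isNilpotent_of_mul_sub_mul_eq_smul (neg_ne_zero.mpr two_ne_zero)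
      (by rw [hhf, neg_smul])) hef' hhe hhf
  have hs_inj : Function.Injective s := ((Module.End.isUnit_iff s).mp hs).injective
  have hle (η : Module.Dual k t) :
      Module.finrank k (W η) ≤ Module.finrank k (W (η - η h • α)) := by
    rw [(Submodule.equivMapOfInjective s hs_inj (W η)).finrank_eq]
    refine Submodule.finrank_mono ?_
    rintro _ ⟨v, hv, rfl⟩
    rw [hW]
    intro H
    have hα' : α (H - α H • h) = -α H := by
      rw [map_sub, map_smul, hαh, smul_eq_mul]
      ring
    have key := LinearMap.congr_fun (hsx (ρ (H - α H • h : t)) (-α H)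
      (by rw [hHe, hα']) (by rw [hHf, hα'])) v
    have hv' := (hW η v).mp hv (H - α H • h)
    rw [Module.End.mul_apply, hv'] at key
    simp only [AddSubgroupClass.coe_sub, SetLike.val_smul, map_sub, map_smul, neg_smul,
      sub_neg_eq_add, sub_add_cancel, Module.End.mul_apply] at key
    rw [← key]
    simp [mul_comm]
  have hrefl : θ - θ h • α - (θ - θ h • α) h • α = θ := by
    simp only [LinearMap.sub_apply, LinearMap.smul_apply, hαh, smul_eq_mul]
    module
  exact le_antisymm (hle θ) ((hle _).trans_eq (by rw [hrefl]))

section InvariantForms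

variable {k L : Type*} [Field k] [LieRing L] [LieAlgebra k L] {t : LieSubalgebra k L}

theorem lie_mem_evenSpace_add {μ ν : Module.Dual k t} {x y : L} (hx : x ∈ evenSpace t μ)
    (hy : y ∈ evenSpace t ν) : ⁅x, y⁆ ∈ evenSpace t (μ + ν) := by
  intro H
  rw [leibniz_lie, hx H, hy H, smul_lie, lie_smul, ← add_smul, LinearMap.add_apply]

variable {B : L →ₗ[k] L →ₗ[k] k} (hB : ∀ x y z, B ⁅x, y⁆ z = B x ⁅y, z⁆)

include hB

theorem apply_lie_eq_neg_smul {ν : Module.Dual k t} {y : L} (hy : y ∈ evenSpace t ν) (H : t)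
    (x : L) : B ⁅(H : L), x⁆ y = -ν H * B x y := by
  rw [← lie_skew, map_neg, LinearMap.neg_apply, hB, hy H, map_smul, smul_eq_mul, neg_mul]

theorem apply_eq_zero_of_mem_evenSpace {μ ν : Module.Dual k t} (hμν : μ + ν ≠ 0) {x y : L}
    (hx : x ∈ evenSpace t μ) (hy : y ∈ evenSpace t ν) : B x y = 0 := by
  obtain ⟨H, hH⟩ := DFunLike.ne_iff.mp hμν
  have h := apply_lie_eq_neg_smul hB hy H x
  rw [hx H, map_smul, LinearMap.smul_apply, smul_eq_mul] at h
  have : (μ + ν) H * B x y = 0 := by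
    rw [LinearMap.add_apply]
    linear_combination h
  exact (mul_eq_zero.mp this).resolve_left hH

theorem apply_eq_zero_of_mem_of_mem_evenSpace [LieRing.IsNilpotent t] {ν : Module.Dual k t}
    (hν : ν ≠ 0) (x : t) {y : L} (hy : y ∈ evenSpace t ν) : B x y = 0 := by
  obtain ⟨H, hH⟩ := DFunLike.ne_iff.mp hν
  have hpow (n : ℕ) :
      B ((LieModule.toEnd k t t H ^ n) x : t) y = (-ν H) ^ n * B x y := by
    induction n with
    | zero => simp
    | succ n ih =>
      rw [pow_succ', Module.End.mul_apply, LieModule.toEnd_apply_apply, LieSubalgebra.coe_bracket,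
        apply_lie_eq_neg_smul hB hy, ih]
      ring
  obtain ⟨n, hn⟩ := LieModule.exists_forall_pow_toEnd_eq_zero k t t
  have h := hpow n
  rw [hn, LinearMap.zero_apply, ZeroMemClass.coe_zero, map_zero, LinearMap.zero_apply] at h
  exact (mul_eq_zero.mp h.symm).resolve_left (pow_ne_zero n (neg_ne_zero.mpr hH))

end InvariantForms

section RootVectors

variable {k L : Type*} [Field k] [LieRing L] [LieAlgebra k L] {t : LieSubalgebra k L}
  {Φ : Set (Module.Dual k t)}

theorem eq_zero_of_forall_mem_evenSpace (htop : t.toSubmodule ⊔ (⨆ α ∈ Φ, evenSpace t α) = ⊤)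
    {V : Type*} [AddCommGroup V] [Module k V] {φ : L →ₗ[k] V} (h₁ : ∀ H : t, φ H = 0)
    (h₂ : ∀ β ∈ Φ, ∀ y ∈ evenSpace t β, φ y = 0) : φ = 0 := by
  rw [← LinearMap.ker_eq_top, eq_top_iff, ← htop]
  exact sup_le (fun x hx ↦ h₁ ⟨x, hx⟩) (iSup₂_le h₂)

variable [LieRing.IsNilpotent t] {B : L →ₗ[k] L →ₗ[k] k}
  (htop : t.toSubmodule ⊔ (⨆ α ∈ Φ, evenSpace t α) = ⊤)
  (hΦ : ∀ α ∈ Φ, α ≠ 0) (hB : ∀ x y z, B ⁅x, y⁆ z = B x ⁅y, z⁆)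
  (hsymm : ∀ x y, B x y = B y x) (hnondeg : ∀ x, (∀ y, B x y = 0) → x = 0)

include htop hB hnondeg

include hsymm in
theorem exists_mem_evenSpace_neg_apply_eq {α : Module.Dual k t} (hα : α ≠ 0) {e : L}
    (he : e ∈ evenSpace t α) (he0 : e ≠ 0) (c : k) : ∃ f ∈ evenSpace t (-α), B e f = c := by
  suffices ∃ f ∈ evenSpace t (-α), B e f ≠ 0 by
    obtain ⟨f, hf, hef⟩ := this
    exact ⟨(c * (B e f)⁻¹) • f, Submodule.smul_mem _ _ hf, by simp [hef]⟩
  by_contra! hcon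
  refine he0 (hnondeg e fun y ↦ ?_)
  rw [eq_zero_of_forall_mem_evenSpace (φ := B e) htop (fun H ↦ ?_) fun β hβ y hy ↦ ?_,
    LinearMap.zero_apply]
  · rw [hsymm]
    exact apply_eq_zero_of_mem_of_mem_evenSpace hB hα H he
  · rcases eq_or_ne (α + β) 0 with h | h
    · exact hcon y (eq_neg_of_add_eq_zero_right h ▸ hy)
    · exact apply_eq_zero_of_mem_evenSpace hB h he hy

include hΦ

theorem lie_eq_smul_of_mem_evenSpace_neg {α : Module.Dual k t} {e f : L}
    (he : e ∈ evenSpace t α) (hf : f ∈ evenSpace t (-α)) {Hα : t} (hHα : ∀ H : t, α H = B Hα H) :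
    ⁅e, f⁆ = B e f • (Hα : L) := by
  rw [← sub_eq_zero]
  refine hnondeg _ fun y ↦ ?_
  rw [eq_zero_of_forall_mem_evenSpace (φ := B (⁅e, f⁆ - B e f • (Hα : L))) htop (fun H ↦ ?_)
    fun β hβ y hy ↦ ?_, LinearMap.zero_apply]
  · rw [map_sub, map_smul, LinearMap.sub_apply, LinearMap.smul_apply, ← hHα, hB, ← lie_skew, hf H]
    simp [mul_comm]
  · have h₁ : B ⁅e, f⁆ y = 0 := apply_eq_zero_of_mem_evenSpace hB
      (by simpa using hΦ β hβ) (lie_mem_evenSpace_add he hf) hy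
    have h₂ : B Hα y = 0 := apply_eq_zero_of_mem_of_mem_evenSpace hB (hΦ β hβ) Hα hy
    simp [h₁, h₂]

include hsymm in
theorem root_apply_ne_zero [CharZero k] [FiniteDimensional k L]
    (hrad : LieAlgebra.radical k L = LieAlgebra.center k L)
    (hΦ' : ∀ α ∈ Φ, evenSpace t α ≠ ⊥) {α : Module.Dual k t} (hα : α ∈ Φ)
    {Hα : t} (hHα : ∀ H : t, α H = B Hα H) : α Hα ≠ 0 := by
  intro h0
  obtain ⟨e, he, he0⟩ := Submodule.exists_mem_ne_zero_of_ne_bot (hΦ' α hα)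
  obtain ⟨f, hf, hef⟩ :=
    exists_mem_evenSpace_neg_apply_eq htop hB hsymm hnondeg (hΦ α hα) he he0 1
  have hlie {y : L} (hy : y ∈ evenSpace t (-α)) : ⁅e, y⁆ = B e y • (Hα : L) :=
    lie_eq_smul_of_mem_evenSpace_neg htop hΦ hB hnondeg he hy hHα
  have hz : ⁅e, f⁆ = Hα := by rw [hlie hf, hef, one_smul]
  have hze : ⁅(Hα : L), e⁆ = 0 := by rw [he Hα, h0, zero_smul]
  have hzf : ⁅(Hα : L), f⁆ = 0 := by rw [hf Hα, LinearMap.neg_apply, h0, neg_zero, zero_smul]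
  have had (x y : L) : (LieAlgebra.ad k L x * LieAlgebra.ad k L y -
      LieAlgebra.ad k L y * LieAlgebra.ad k L x) = LieAlgebra.ad k L ⁅x, y⁆ := by
    ext w
    simp
  have hcomm {x y : L} (h : ⁅x, y⁆ = 0) : Commute (LieAlgebra.ad k L x) (LieAlgebra.ad k L y) := by
    rw [commute_iff_eq, ← sub_eq_zero, had, h, map_zero]
  have hβ {β : Module.Dual k t} (hβ : β ∈ Φ) : β Hα = 0 := by
    obtain ⟨v, hv, hv0⟩ := Submodule.exists_mem_ne_zero_of_ne_bot (hΦ' β hβ)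
    refine eq_zero_of_hasEigenvalue_commutator (had e f) (by rw [hz]; exact hcomm hze)
      (by rw [hz]; exact hcomm hzf) (c := β Hα) ?_
    refine Module.End.hasEigenvalue_of_hasEigenvector (x := v) ⟨?_, hv0⟩
    rw [Module.End.mem_eigenspace_iff, hz, LieAlgebra.ad_apply, hv Hα]
  have hz_zero : (Hα : L) ∈ evenSpace t 0 := by
    have := lie_mem_evenSpace_add he hf
    rwa [add_neg_cancel, hz] at this
  have hz_ad : LieAlgebra.ad k L Hα = 0 := by
    refine eq_zero_of_forall_mem_evenSpace htop (fun H ↦ ?_) fun β hβΦ y hy ↦ ?_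
    · rw [LieAlgebra.ad_apply, ← lie_skew, hz_zero H, LinearMap.zero_apply, zero_smul, neg_zero]
    · rw [LieAlgebra.ad_apply, hy Hα, hβ hβΦ, zero_smul]
  obtain ⟨H, hH⟩ := DFunLike.ne_iff.mp (hΦ α hα)
  have he_nil : IsNilpotent (LieAlgebra.ad k L e) :=
    isNilpotent_of_mul_sub_mul_eq_smul (x := LieAlgebra.ad k L H) hH (by rw [had, he H, map_smul])
  have hκ : ∀ x y z, killingForm k L ⁅x, y⁆ z = killingForm k L x ⁅y, z⁆ :=
    LieModule.traceForm_apply_lie_apply k L L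
  have he_killing : killingForm k L e = 0 := by
    refine eq_zero_of_forall_mem_evenSpace htop (fun H ↦ ?_) fun β hβΦ y hy ↦ ?_
    · rw [LieModule.traceForm_comm]
      exact apply_eq_zero_of_mem_of_mem_evenSpace hκ (hΦ α hα) H he
    · rcases eq_or_ne (α + β) 0 with h | h
      · have hcom : Commute (LieAlgebra.ad k L e) (LieAlgebra.ad k L y) := by
          rw [commute_iff_eq, ← sub_eq_zero, had, hlie (eq_neg_of_add_eq_zero_right h ▸ hy),
            map_smul, hz_ad, smul_zero]
        rw [killingForm_apply_apply]
        exact (LinearMap.isNilpotent_trace_of_isNilpotent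
          (hcom.isNilpotent_mul_right he_nil)).eq_zero
      · exact apply_eq_zero_of_mem_evenSpace hκ h he hy
  have he_center : e ∈ LieAlgebra.center k L := by
    rw [← hrad]
    refine LieAlgebra.killingCompl_top_le_radical k L ?_
    rw [LieIdeal.mem_killingCompl]
    intro y _
    rw [LieModule.traceForm_comm, he_killing, LinearMap.zero_apply]
  have hHe := (LieModule.mem_maxTrivSubmodule k L L e).mp he_center H
  rw [he H, smul_eq_zero] at hHe
  exact hHe.elim hH he0

theorem exists_sl2_of_mem_roots [CharZero k] [FiniteDimensional k L]
    (hsymm : ∀ x y, B x y = B y x)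
    (hΦ' : ∀ α ∈ Φ, evenSpace t α ≠ ⊥) {α : Module.Dual k t} (hα : α ∈ Φ)
    {Hα : t} (hHα : ∀ H : t, α H = B Hα H) :
    ∃ e ∈ evenSpace t α, ∃ f ∈ evenSpace t (-α), ⁅e, f⁆ = ((2 * (α Hα)⁻¹) • Hα : t) := by
  obtain ⟨e, he, he0⟩ := Submodule.exists_mem_ne_zero_of_ne_bot (hΦ' α hα)
  obtain ⟨f, hf, hef⟩ := exists_mem_evenSpace_neg_apply_eq htop hB hsymm hnondeg (hΦ α hα) he
    he0 (2 * (α Hα)⁻¹)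
  exact ⟨e, he, f, hf, by
    rw [lie_eq_smul_of_mem_evenSpace_neg htop hΦ hB hnondeg he hf hHα, hef,
      SetLike.val_smul]⟩

end RootVectors

open Pointwise

theorem stmt_6 {k g0 g1 : Type*} [Field k] [IsAlgClosed k] [CharZero k]
    [LieRing g0] [LieAlgebra k g0] [FiniteDimensional k g0]
    [AddCommGroup g1] [Module k g1] [FiniteDimensional k g1]
    (D : LieSuperData k g0 g1)
    (hred : LieAlgebra.radical k g0 = LieAlgebra.center k g0)
    (t : LieSubalgebra k g0) (hC : t.IsCartanSubalgebra)
    (Φ Γ : Set (Module.Dual k t))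
    (hΦ : ∀ α : Module.Dual k t, α ∈ Φ ↔ (α ≠ 0 ∧ evenSpace t α ≠ ⊥))
    (hΓ : ∀ γ : Module.Dual k t, γ ∈ Γ ↔ oddSpace D t γ ≠ ⊥)
    (hΓ0 : (0 : Module.Dual k t) ∉ Γ)
    (hdisj : Φ ∩ Γ = ∅)
    (hg0 : t.toSubmodule ⊔ (⨆ α ∈ Φ, evenSpace t α) = ⊤)
    (hg1 : (⨆ γ ∈ Γ, oddSpace D t γ) = ⊤)
    (F : InvForm D)
    (Hd : Module.Dual k t → t)
    (hHd : ∀ (θ : Module.Dual k t) (H : t), θ H = F.B0 (Hd θ : g0) (H : g0)) :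
    ∀ α ∈ Φ, ∀ θ ∈ Φ ∪ Γ,
      (∃ n : ℤ, (n : k) = (2 * (pairing F.B0 Hd α α)⁻¹ * pairing F.B0 Hd θ α)) ∧
      θ - (2 * (pairing F.B0 Hd α α)⁻¹ * pairing F.B0 Hd θ α) • α ∈ Φ ∪ Γ ∧
      (θ ∈ Φ → Module.finrank k (evenSpace t θ) =
        Module.finrank k (evenSpace t (θ - (2 * (pairing F.B0 Hd α α)⁻¹ * pairing F.B0 Hd θ α) • α))) ∧
      (θ ∈ Γ → Module.finrank k (oddSpace D t θ) =
        Module.finrank k (oddSpace D t (θ - (2 * (pairing F.B0 Hd α α)⁻¹ * pairing F.B0 Hd θ α) • α))) := by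
  intro α hα θ hθ
  have : LieRing.IsNilpotent t := hC.nilpotent
  have hΦ0 : ∀ β ∈ Φ, β ≠ 0 := fun β hβ ↦ ((hΦ β).mp hβ).1
  have hΦ' : ∀ β ∈ Φ, evenSpace t β ≠ ⊥ := fun β hβ ↦ ((hΦ β).mp hβ).2
  have hαα : α (Hd α) ≠ 0 := root_apply_ne_zero hg0 hΦ0 F.B0_invariant F.B0_symm F.B0_nondeg hred
    hΦ' hα (hHd α)
  obtain ⟨e, he, f, hf, hef⟩ := exists_sl2_of_mem_roots hg0 hΦ0 F.B0_invariant F.B0_nondeg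
    F.B0_symm hΦ' hα (hHd α)
  set h : t := (2 * (α (Hd α))⁻¹) • Hd α with h_def
  have hscalar (η : Module.Dual k t) :
      2 * (pairing F.B0 Hd α α)⁻¹ * pairing F.B0 Hd η α = η h := by
    rw [pairing, pairing, ← hHd, ← hHd, h_def, map_smul, smul_eq_mul]
  have hαh : α h = 2 := by
    rw [h_def, map_smul, smul_eq_mul, mul_assoc, inv_mul_cancel₀ hαα, mul_one]
  rw [hscalar]
  have heven := exists_intCast_eq_and_finrank_eq_of_representation
    (LieAlgebra.ad k g0 : g0 →ₗ[k] Module.End k g0) (fun x y ↦ by ext z; simp) t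
    (evenSpace t) (fun _ _ ↦ Iff.rfl) hαh he hf hef θ
  have hodd := exists_intCast_eq_and_finrank_eq_of_representation
    D.act (fun x y ↦ by ext u; exact D.act_lie x y u) t
    (oddSpace D t) (fun _ _ ↦ Iff.rfl) hαh he hf hef θ
  refine ⟨?_, ?_, fun _ ↦ heven.2, fun _ ↦ hodd.2⟩
  · exact hθ.elim (fun hθ ↦ heven.1 (hΦ' θ hθ)) fun hθ ↦ hodd.1 ((hΓ θ).mp hθ)
  · rcases hθ with hθ | hθ
    · refine Or.inl ((hΦ _).mpr ⟨fun h0 ↦ hΦ0 θ hθ ?_, fun hbot ↦ hΦ' θ hθ ?_⟩)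
      · have h2 : θ h = 0 := by
          have := LinearMap.congr_fun h0 h
          simp only [LinearMap.sub_apply, LinearMap.smul_apply, hαh, smul_eq_mul,
            LinearMap.zero_apply] at this
          linear_combination -this
        rwa [h2, zero_smul, sub_zero] at h0
      · rw [← Submodule.finrank_eq_zero, heven.2, hbot, finrank_bot]
    · refine Or.inr ((hΓ _).mpr fun hbot ↦ (hΓ θ).mp hθ ?_)
      rw [← Submodule.finrank_eq_zero, hodd.2, hbot, finrank_bot]
end

section
/- Let γ, ν ∈ Γ be linearly independent over k with (γ,ν) ≠ 0. Then γ+ν ∈ R or γ−ν ∈ R. -/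
open Pointwise

section WeightSpaces

variable {k g0 g1 : Type*} [Field k] [LieRing g0] [LieAlgebra k g0]
  [AddCommGroup g1] [Module k g1]

theorem br_mem_evenSpace (D : LieSuperData k g0 g1) (t : LieSubalgebra k g0)
    {γ δ : Module.Dual k t} {u v : g1} (hu : u ∈ oddSpace D t γ) (hv : v ∈ oddSpace D t δ) :
    D.br u v ∈ evenSpace t (γ + δ) := by
  intro H
  rw [D.br_invariance, hu H, hv H, map_smul, map_smul, LinearMap.smul_apply,
    LinearMap.add_apply, add_smul]

theorem evenSpace_zero_le (t : LieSubalgebra k g0) (hC : t.IsCartanSubalgebra)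
    {x : g0} (hx : x ∈ evenSpace t 0) : x ∈ t := by
  rw [← hC.self_normalizing, LieSubalgebra.mem_normalizer_iff]
  intro y hy
  have h := hx ⟨y, hy⟩
  simp only [LinearMap.zero_apply, zero_smul] at h
  rw [← lie_skew, h, neg_zero]
  exact t.zero_mem

theorem InvForm.add_eq_zero_of_B0_ne_zero {D : LieSuperData k g0 g1} (F : InvForm D)
    (t : LieSubalgebra k g0) {α β : Module.Dual k t} {x y : g0}
    (hx : x ∈ evenSpace t α) (hy : y ∈ evenSpace t β) (h : F.B0 x y ≠ 0) : α + β = 0 := by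
  ext H
  have h1 := F.B0_invariant x H y
  rw [← lie_skew, hx H, hy H, map_neg, map_smul, map_smul, LinearMap.neg_apply,
    LinearMap.smul_apply, smul_eq_mul, smul_eq_mul] at h1
  have h2 : (α H + β H) * F.B0 x y = 0 := by linear_combination -h1
  simpa [h] using h2

theorem InvForm.add_eq_zero_of_B1_ne_zero {D : LieSuperData k g0 g1} (F : InvForm D)
    (t : LieSubalgebra k g0) {γ δ : Module.Dual k t} {u v : g1}
    (hu : u ∈ oddSpace D t γ) (hv : v ∈ oddSpace D t δ) (h : F.B1 u v ≠ 0) : γ + δ = 0 := by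
  ext H
  have h1 := F.compat H u v
  rw [D.br_symm, F.compat, hu H, hv H, map_smul, map_smul, LinearMap.smul_apply,
    LinearMap.smul_apply, F.B1_alt v u, smul_eq_mul, smul_eq_mul] at h1
  have h2 : (γ H + δ H) * F.B1 u v = 0 := by linear_combination -h1
  simpa [h] using h2

/-- Opposite odd weight spaces are paired nondegenerately. -/
theorem InvForm.exists_B1_ne_zero {D : LieSuperData k g0 g1} (F : InvForm D)
    (t : LieSubalgebra k g0) {Γ : Set (Module.Dual k t)}
    (hg1 : (⨆ γ ∈ Γ, oddSpace D t γ) = ⊤) {γ : Module.Dual k t} {u : g1}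
    (hu : u ∈ oddSpace D t γ) (hu0 : u ≠ 0) : ∃ v ∈ oddSpace D t (-γ), F.B1 u v ≠ 0 := by
  by_contra! hcon
  refine hu0 (F.B1_nondeg u fun v => ?_)
  have hle : (⨆ δ ∈ Γ, oddSpace D t δ) ≤ LinearMap.ker (F.B1 u) := by
    refine iSup₂_le fun δ _ w hw => ?_
    by_contra hne
    have hδ := F.add_eq_zero_of_B1_ne_zero t hu hw hne
    rw [eq_neg_of_add_eq_zero_right hδ] at hw
    exact hne (hcon w hw)
  exact hle (hg1 ▸ Submodule.mem_top)

/-- An even weight vector of nonzero weight is orthogonal to `t`. -/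
theorem InvForm.B0_eq_zero_of_mem {D : LieSuperData k g0 g1} (F : InvForm D)
    (t : LieSubalgebra k g0) {α : Module.Dual k t} (hα : α ≠ 0) {x : g0}
    (hx : x ∈ evenSpace t α) (H : t) : F.B0 x H = 0 := by
  have key : ∀ K L : t, F.B0 x ⁅(K : g0), (L : g0)⁆ = -(α K * F.B0 x L) := by
    intro K L
    rw [← F.B0_invariant, ← lie_skew, hx K, map_neg, map_smul, LinearMap.neg_apply,
      LinearMap.smul_apply, smul_eq_mul]
  obtain ⟨K, hK⟩ : ∃ K, α K ≠ 0 := by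
    by_contra! hcon
    exact hα (LinearMap.ext hcon)
  have hxK : F.B0 x K = 0 := by
    have := key K K
    rw [lie_self, map_zero] at this
    simpa [hK] using this.symm
  have h1 := key K H
  have h2 := key H K
  rw [← lie_skew, map_neg, h1, hxK] at h2
  simpa [hK] using h2

/-- An even weight space of nonzero weight vanishes if the opposite weight is not an even root. -/
theorem InvForm.eq_zero_of_neg_notMem {D : LieSuperData k g0 g1} (F : InvForm D)
    (t : LieSubalgebra k g0) {Φ : Set (Module.Dual k t)}
    (hg0 : t.toSubmodule ⊔ (⨆ α ∈ Φ, evenSpace t α) = ⊤)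
    {α : Module.Dual k t} (hα : α ≠ 0) (hneg : -α ∉ Φ) {x : g0} (hx : x ∈ evenSpace t α) :
    x = 0 := by
  refine F.B0_nondeg x fun y => ?_
  have hle : t.toSubmodule ⊔ (⨆ β ∈ Φ, evenSpace t β) ≤ LinearMap.ker (F.B0 x) := by
    refine sup_le (fun H hH => F.B0_eq_zero_of_mem t hα hx ⟨H, hH⟩) (iSup₂_le fun β hβ w hw => ?_)
    by_contra hne
    have h := F.add_eq_zero_of_B0_ne_zero t hx hw hne
    exact hneg (eq_neg_of_add_eq_zero_right h ▸ hβ)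
  exact hle (hg0 ▸ Submodule.mem_top)

end WeightSpaces

theorem stmt_7 {k g0 g1 : Type*} [Field k] [IsAlgClosed k] [CharZero k]
    [LieRing g0] [LieAlgebra k g0] [FiniteDimensional k g0]
    [AddCommGroup g1] [Module k g1] [FiniteDimensional k g1]
    (D : LieSuperData k g0 g1)
    (hred : LieAlgebra.radical k g0 = LieAlgebra.center k g0)
    (t : LieSubalgebra k g0) (hC : t.IsCartanSubalgebra)
    (Φ Γ : Set (Module.Dual k t))
    (hΦ : ∀ α : Module.Dual k t, α ∈ Φ ↔ (α ≠ 0 ∧ evenSpace t α ≠ ⊥))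
    (hΓ : ∀ γ : Module.Dual k t, γ ∈ Γ ↔ oddSpace D t γ ≠ ⊥)
    (hΓ0 : (0 : Module.Dual k t) ∉ Γ)
    (hdisj : Φ ∩ Γ = ∅)
    (hg0 : t.toSubmodule ⊔ (⨆ α ∈ Φ, evenSpace t α) = ⊤)
    (hg1 : (⨆ γ ∈ Γ, oddSpace D t γ) = ⊤)
    (F : InvForm D)
    (Hd : Module.Dual k t → t)
    (hHd : ∀ (θ : Module.Dual k t) (H : t), θ H = F.B0 (Hd θ : g0) (H : g0))
    (γ ν : Module.Dual k t) (hγ : γ ∈ Γ) (hν : ν ∈ Γ)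
    (hli : LinearIndependent k ![γ, ν]) (hp : pairing F.B0 Hd γ ν ≠ 0) :
    γ + ν ∈ Φ ∪ Γ ∨ γ - ν ∈ Φ ∪ Γ := by
  by_contra! hcon
  obtain ⟨hadd, hsub⟩ := hcon
  rw [LinearIndependent.pair_iff] at hli
  have hadd0 : γ + ν ≠ 0 := fun h => one_ne_zero (hli 1 1 (by simpa using h)).1
  have hsub0 : -γ + ν ≠ 0 := fun h => one_ne_zero (hli (-1) 1 (by simpa using h)).2
  obtain ⟨u, hu, hu0⟩ := (Submodule.ne_bot_iff _).1 ((hΓ γ).1 hγ)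
  obtain ⟨w, hw, hw0⟩ := (Submodule.ne_bot_iff _).1 ((hΓ ν).1 hν)
  obtain ⟨v, hv, huv⟩ := F.exists_B1_ne_zero t hg1 hu hu0
  have hwu : D.br w u = 0 := by
    have hbot : evenSpace t (γ + ν) = ⊥ := by
      by_contra hne
      exact hadd (Or.inl ((hΦ _).2 ⟨hadd0, hne⟩))
    have hmem := br_mem_evenSpace D t hu hw
    rwa [hbot, Submodule.mem_bot, D.br_symm] at hmem
  have hvw : D.br v w = 0 := by
    refine F.eq_zero_of_neg_notMem t hg0 hsub0 (fun h => hsub (Or.inl ?_))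
      (br_mem_evenSpace D t hv hw)
    rwa [neg_add, neg_neg, ← sub_eq_add_neg] at h
  have ht : D.br u v ∈ t := by
    refine evenSpace_zero_le t hC ?_
    simpa using br_mem_evenSpace D t hu hv
  have hact : D.act (D.br u v) w = 0 := by
    simpa [hwu, hvw] using D.super_jacobi u v w
  have hval : ν ⟨D.br u v, ht⟩ = pairing F.B0 Hd γ ν * F.B1 u v := by
    rw [hHd, F.compat, hu, map_smul, LinearMap.smul_apply, smul_eq_mul, hHd]
    rfl
  rw [hw ⟨D.br u v, ht⟩, hval] at hact
  exact smul_ne_zero (mul_ne_zero hp huv) hw0 hact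
end
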